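/- Let (T_min, T_min†) be a Fredholm FAP and B ⊆ ȟ a boundary condition (closed subspace). Then T_B is a Fredholm operator if and only if (B, C) is a Fredholm pair in ȟ, where C is the Hardy space. In that case, B* ∩ C† ≅ ȟ/(B + C) and ind(T_B) = ind(B, C) + dim ker(T_min) − dim ker(T_min†), where ind(B, C) := dim(B ∩ C) − dim(ȟ/(B + C)). -/

import Mathlib

open scoped InnerProductSpace ComplexConjugate
noncomputable section

variable {H₁ H₂ : Type*} [NormedAddCommGroup H₁] [InnerProductSpace ℂ H₁] [CompleteSpace H₁]
  [NormedAddCommGroup H₂] [InnerProductSpace ℂ H₂] [CompleteSpace H₂]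

/-- The domain of a graph submodule `G ⊆ E × F`, i.e. the first-coordinate projection. -/
def domOf {E F : Type*} [AddCommGroup E] [AddCommGroup F] [Module ℂ E] [Module ℂ F]
    (G : Submodule ℂ (E × F)) : Submodule ℂ E := G.map (LinearMap.fst ℂ E F)

/-- The range of (the operator with) graph `G ⊆ E × F`. -/
def ranOf {E F : Type*} [AddCommGroup E] [AddCommGroup F] [Module ℂ E] [Module ℂ F]
    (G : Submodule ℂ (E × F)) : Submodule ℂ F := G.map (LinearMap.snd ℂ E F)

/-- The kernel of (the operator with) graph `G ⊆ E × F`: those `x` with `(x, 0) ∈ G`. -/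
def kerOf {E F : Type*} [AddCommGroup E] [AddCommGroup F] [Module ℂ E] [Module ℂ F]
    (G : Submodule ℂ (E × F)) : Submodule ℂ E := G.comap (LinearMap.inl ℂ E F)

/-- The graph of `T_min` viewed as a submodule of the graph of `T_max := (T_min†)*`
(the latter is identified with `dom T_max` equipped with the graph norm). -/
def minSub (Tmin : H₁ →ₗ.[ℂ] H₂) (Tdag : H₂ →ₗ.[ℂ] H₁) : Submodule ℂ Tdag.adjoint.graph :=
  Submodule.comap Tdag.adjoint.graph.subtype Tmin.graph

/-- The Cauchy data space `ȟ := dom(T_max)/dom(T_min)` of the FAP `(T_min, T_min†)`,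
realised as the quotient of the graph of `T_max = (T_min†)*` by the graph of `T_min`. -/
abbrev HCheck (Tmin : H₁ →ₗ.[ℂ] H₂) (Tdag : H₂ →ₗ.[ℂ] H₁) :=
  Tdag.adjoint.graph ⧸ minSub Tmin Tdag

/-- The graph of the realisation `T_B` determined by a (generalised) boundary condition
`B ⊆ ȟ`, namely `{v ∈ dom T_max : γ v ∈ B}` together with the values of `T_max`. -/
def bGraph (Tmin : H₁ →ₗ.[ℂ] H₂) (Tdag : H₂ →ₗ.[ℂ] H₁)
    (B : Submodule ℂ (HCheck Tmin Tdag)) : Submodule ℂ (H₁ × H₂) :=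
  Submodule.map Tdag.adjoint.graph.subtype (Submodule.comap (minSub Tmin Tdag).mkQ B)

/-- The realisation `T_B` of the FAP determined by the boundary condition `B`. -/
def TB (Tmin : H₁ →ₗ.[ℂ] H₂) (Tdag : H₂ →ₗ.[ℂ] H₁)
    (B : Submodule ℂ (HCheck Tmin Tdag)) : H₁ →ₗ.[ℂ] H₂ :=
  (bGraph Tmin Tdag B).toLinearPMap

/-- The Hardy space `C := γ(ker T_max) ⊆ ȟ`. -/
def hardy (Tmin : H₁ →ₗ.[ℂ] H₂) (Tdag : H₂ →ₗ.[ℂ] H₁) : Submodule ℂ (HCheck Tmin Tdag) :=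
  Submodule.map (minSub Tmin Tdag).mkQ
    (Submodule.comap Tdag.adjoint.graph.subtype (LinearMap.ker (LinearMap.snd ℂ H₁ H₂)))

/-- The graph of the realisation `T†_{B*}` of `T_min†` determined by the adjoint boundary
condition `B*` (cf. Statement 5). -/
def adjGraph (Tmin : H₁ →ₗ.[ℂ] H₂) (Tdag : H₂ →ₗ.[ℂ] H₁)
    (B : Submodule ℂ (HCheck Tmin Tdag)) : Submodule ℂ (H₂ × H₁) where
  carrier := {q | q ∈ Tmin.adjoint.graph ∧
    ∀ p ∈ bGraph Tmin Tdag B, ⟪q.2, p.1⟫_ℂ = ⟪q.1, p.2⟫_ℂ}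
  add_mem' := by
    rintro q q' ⟨hq, hq2⟩ ⟨hq', hq'2⟩
    refine ⟨Submodule.add_mem _ hq hq', fun p hp => ?_⟩
    simp only [Prod.fst_add, Prod.snd_add, inner_add_left]
    rw [hq2 p hp, hq'2 p hp]
  zero_mem' := ⟨Submodule.zero_mem _, fun p _ => by simp⟩
  smul_mem' := by
    rintro c q ⟨hq, hq2⟩
    refine ⟨Submodule.smul_mem _ c hq, fun p hp => ?_⟩
    simp only [Prod.smul_fst, Prod.smul_snd, inner_smul_left]
    rw [hq2 p hp]

/-- The adjoint boundary condition `B* ⊆ ȟ†` of `B`, i.e. the annihilator of `B` under the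
boundary pairing, realised as `γ†(dom T†_{B*})` in the Cauchy data space of the adjoint
FAP `(T_min†, T_min)`. -/
def adjBC (Tmin : H₁ →ₗ.[ℂ] H₂) (Tdag : H₂ →ₗ.[ℂ] H₁)
    (B : Submodule ℂ (HCheck Tmin Tdag)) : Submodule ℂ (HCheck Tdag Tmin) :=
  Submodule.map (minSub Tdag Tmin).mkQ
    (Submodule.comap Tmin.adjoint.graph.subtype (adjGraph Tmin Tdag B))

set_option linter.unusedSectionVars false

/-- Membership in the graph of the adjoint of a densely defined operator. -/
theorem mem_graph_adjoint_iff {E F : Type*} [NormedAddCommGroup E] [InnerProductSpace ℂ E]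
    [CompleteSpace E] [NormedAddCommGroup F] [InnerProductSpace ℂ F] (T : E →ₗ.[ℂ] F)
    (hT : Dense (T.domain : Set E)) (q : F × E) :
    q ∈ T.adjoint.graph ↔ ∀ p ∈ T.graph, ⟪p.2, q.1⟫_ℂ = ⟪p.1, q.2⟫_ℂ := by
  rw [LinearPMap.adjoint_graph_eq_graph_adjoint hT, Submodule.mem_adjoint_iff]
  simp only [sub_eq_zero, Prod.forall]

/-- Closed range theorem: the adjoint of a closed, densely defined operator with closed range
has range the orthogonal complement of the kernel. -/
theorem ranOf_graph_adjoint {E F : Type*} [NormedAddCommGroup E] [InnerProductSpace ℂ E]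
    [CompleteSpace E] [NormedAddCommGroup F] [InnerProductSpace ℂ F] [CompleteSpace F]
    (T : E →ₗ.[ℂ] F) (hT : Dense (T.domain : Set E)) (hc : T.IsClosed)
    (hr : IsClosed ((ranOf T.graph : Submodule ℂ F) : Set F)) :
    ranOf T.adjoint.graph = (kerOf T.graph)ᗮ := by
  apply le_antisymm
  · rintro _ ⟨q, hq, rfl⟩ k hk
    have h := (mem_graph_adjoint_iff T hT q).1 hq (k, 0) hk
    simpa using h.symm
  intro z hz
  have hker : ∀ p ∈ T.graph, p.2 = 0 → ⟪z, p.1⟫_ℂ = 0 := by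
    rintro ⟨a, b⟩ hp (rfl : b = 0)
    exact Submodule.inner_left_of_mem_orthogonal (K := kerOf T.graph) hp hz
  have : CompleteSpace T.graph := IsClosed.completeSpace_coe (hs := hc)
  have : CompleteSpace (ranOf T.graph) := IsClosed.completeSpace_coe (hs := hr)
  let f : T.graph →L[ℂ] ranOf T.graph :=
    ((ContinuousLinearMap.snd ℂ E F).comp T.graph.subtypeL).codRestrict (ranOf T.graph)
      fun p => Submodule.mem_map_of_mem p.2
  have hf : Function.Surjective f := by
    rintro ⟨_, p, hp, rfl⟩
    exact ⟨⟨p, hp⟩, rfl⟩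
  obtain ⟨C, -, hC⟩ := f.exists_preimage_norm_le hf
  choose s hs hsC using hC
  have hs' : ∀ b, (s b).1.2 = b.1 := fun b => congrArg Subtype.val (hs b)
  let φ : ranOf T.graph →ₗ[ℂ] ℂ :=
    { toFun := fun b => ⟪z, (s b).1.1⟫_ℂ
      map_add' := fun b c => by
        have h := hker (s (b + c) - s b - s c).1 (s (b + c) - s b - s c).2 (by simp [hs'])
        simp only [Submodule.coe_sub, Prod.fst_sub, inner_sub_right] at h
        linear_combination h
      map_smul' := fun t b => by
        have h := hker (s (t • b) - t • s b).1 (s (t • b) - t • s b).2 (by simp [hs'])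
        simp only [Submodule.coe_sub, Submodule.coe_smul, Prod.fst_sub, Prod.smul_fst,
          inner_sub_right, inner_smul_right] at h
        simp only [RingHom.id_apply, smul_eq_mul]
        linear_combination h }
  have hφ : ∀ b, ‖φ b‖ ≤ (‖z‖ * C) * ‖b‖ := fun b =>
    calc ‖φ b‖ ≤ ‖z‖ * ‖(s b).1.1‖ := norm_inner_le_norm _ _
      _ ≤ ‖z‖ * (C * ‖b‖) := by
        gcongr
        exact (norm_fst_le (s b).1).trans (hsC b)
      _ = _ := by ring
  let w := (InnerProductSpace.toDual ℂ (ranOf T.graph)).symm (φ.mkContinuous _ hφ)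
  refine ⟨((w : F), z), (mem_graph_adjoint_iff T hT _).2 fun p hp => ?_, rfl⟩
  let b : ranOf T.graph := ⟨p.2, Submodule.mem_map_of_mem hp⟩
  have h1 : ⟪(w : F), p.2⟫_ℂ = ⟪z, (s b).1.1⟫_ℂ :=
    InnerProductSpace.toDual_symm_apply (x := b) (y := φ.mkContinuous _ hφ)
  have h2 := hker ((s b).1 - p) (sub_mem (s b).2 hp) (by simp [hs', b])
  simp only [Prod.fst_sub, inner_sub_right] at h2
  rw [← inner_conj_symm p.2, ← inner_conj_symm p.1]
  congr 1
  linear_combination h1 + h2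

theorem mem_bGraph_iff (Tmin : H₁ →ₗ.[ℂ] H₂) (Tdag : H₂ →ₗ.[ℂ] H₁)
    (B : Submodule ℂ (HCheck Tmin Tdag)) (p : H₁ × H₂) :
    p ∈ bGraph Tmin Tdag B ↔
      ∃ h : p ∈ Tdag.adjoint.graph, (minSub Tmin Tdag).mkQ ⟨p, h⟩ ∈ B := by
  constructor
  · rintro ⟨q, hq, rfl⟩
    exact ⟨q.2, hq⟩
  · rintro ⟨h, hB⟩
    exact ⟨⟨p, h⟩, hB, rfl⟩

theorem graph_le_bGraph (Tmin : H₁ →ₗ.[ℂ] H₂) (Tdag : H₂ →ₗ.[ℂ] H₁)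
    (ha : Tmin ≤ Tdag.adjoint) (B : Submodule ℂ (HCheck Tmin Tdag)) :
    Tmin.graph ≤ bGraph Tmin Tdag B := by
  intro p hp
  refine (mem_bGraph_iff ..).2 ⟨LinearPMap.le_graph_of_le ha hp, ?_⟩
  rw [Submodule.mkQ_apply, (Submodule.Quotient.mk_eq_zero _).2]
  · exact B.zero_mem
  · exact hp

/-- The trace map restricted to the kernel of the realisation with boundary condition `B`. -/
def kerTrace (Tmin : H₁ →ₗ.[ℂ] H₂) (Tdag : H₂ →ₗ.[ℂ] H₁)
    (B : Submodule ℂ (HCheck Tmin Tdag)) : kerOf (bGraph Tmin Tdag B) →ₗ[ℂ] HCheck Tmin Tdag :=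
  (minSub Tmin Tdag).mkQ ∘ₗ
    ((LinearMap.inl ℂ H₁ H₂).domRestrict (kerOf (bGraph Tmin Tdag B))).codRestrict
      Tdag.adjoint.graph fun x => ((mem_bGraph_iff Tmin Tdag B _).1 x.2).1

theorem range_kerTrace (Tmin : H₁ →ₗ.[ℂ] H₂) (Tdag : H₂ →ₗ.[ℂ] H₁)
    (B : Submodule ℂ (HCheck Tmin Tdag)) :
    LinearMap.range (kerTrace Tmin Tdag B) = B ⊓ hardy Tmin Tdag := by
  ext b
  constructor
  · rintro ⟨x, rfl⟩
    obtain ⟨h, hB⟩ := (mem_bGraph_iff Tmin Tdag B _).1 x.2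
    exact ⟨hB, ⟨⟨(x.1, 0), h⟩, rfl, rfl⟩⟩
  · rintro ⟨hB, ⟨⟨⟨x, y⟩, hp⟩, (rfl : y = 0), rfl⟩⟩
    exact ⟨⟨x, (mem_bGraph_iff Tmin Tdag B (x, 0)).2 ⟨hp, hB⟩⟩, rfl⟩

theorem ker_kerTrace (Tmin : H₁ →ₗ.[ℂ] H₂) (Tdag : H₂ →ₗ.[ℂ] H₁)
    (B : Submodule ℂ (HCheck Tmin Tdag)) :
    LinearMap.ker (kerTrace Tmin Tdag B) =
      (kerOf Tmin.graph).comap (kerOf (bGraph Tmin Tdag B)).subtype := by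
  ext x
  exact Submodule.Quotient.mk_eq_zero _

/-- The kernel of the trace map on `ker T_B` is `ker T_min`. -/
def kerKerTraceEquiv (Tmin : H₁ →ₗ.[ℂ] H₂) (Tdag : H₂ →ₗ.[ℂ] H₁)
    (ha : Tmin ≤ Tdag.adjoint) (B : Submodule ℂ (HCheck Tmin Tdag)) :
    LinearMap.ker (kerTrace Tmin Tdag B) ≃ₗ[ℂ] kerOf Tmin.graph :=
  (LinearEquiv.ofEq _ _ (ker_kerTrace Tmin Tdag B)).trans
    (Submodule.comapSubtypeEquivOfLe
      (Submodule.comap_mono (graph_le_bGraph Tmin Tdag ha B)))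

/-- A linear map with finite-dimensional kernel and range has finite-dimensional source. -/
theorem finiteDimensional_of_ker_of_range {V W : Type*} [AddCommGroup V] [Module ℂ V]
    [AddCommGroup W] [Module ℂ W] (f : V →ₗ[ℂ] W) (hk : FiniteDimensional ℂ (LinearMap.ker f))
    (hr : FiniteDimensional ℂ (LinearMap.range f)) : FiniteDimensional ℂ V := by
  have : FiniteDimensional ℂ (V ⧸ LinearMap.ker f) := f.quotKerEquivRange.symm.finiteDimensional
  exact Module.Finite.of_submodule_quotient (LinearMap.ker f)

theorem finiteDimensional_kerOf_bGraph_iff (Tmin : H₁ →ₗ.[ℂ] H₂) (Tdag : H₂ →ₗ.[ℂ] H₁)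
    (ha : Tmin ≤ Tdag.adjoint) (hk : FiniteDimensional ℂ (kerOf Tmin.graph))
    (B : Submodule ℂ (HCheck Tmin Tdag)) :
    FiniteDimensional ℂ (kerOf (bGraph Tmin Tdag B)) ↔
      FiniteDimensional ℂ ↥(B ⊓ hardy Tmin Tdag) := by
  rw [← range_kerTrace]
  exact ⟨fun _ => inferInstance, finiteDimensional_of_ker_of_range _
    (kerKerTraceEquiv Tmin Tdag ha B).symm.finiteDimensional⟩

theorem finrank_kerOf_bGraph (Tmin : H₁ →ₗ.[ℂ] H₂) (Tdag : H₂ →ₗ.[ℂ] H₁)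
    (ha : Tmin ≤ Tdag.adjoint) (B : Submodule ℂ (HCheck Tmin Tdag))
    (hK : FiniteDimensional ℂ (kerOf (bGraph Tmin Tdag B))) :
    Module.finrank ℂ (kerOf (bGraph Tmin Tdag B)) =
      Module.finrank ℂ ↥(B ⊓ hardy Tmin Tdag) + Module.finrank ℂ (kerOf Tmin.graph) := by
  rw [← range_kerTrace, ← (kerKerTraceEquiv Tmin Tdag ha B).finrank_eq,
    LinearMap.finrank_range_add_finrank_ker]

theorem snd_mem_ranOf_bGraph_iff (Tmin : H₁ →ₗ.[ℂ] H₂) (Tdag : H₂ →ₗ.[ℂ] H₁)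
    (B : Submodule ℂ (HCheck Tmin Tdag)) (p : Tdag.adjoint.graph) :
    p.1.2 ∈ ranOf (bGraph Tmin Tdag B) ↔
      (minSub Tmin Tdag).mkQ p ∈ B ⊔ hardy Tmin Tdag := by
  constructor
  · rintro ⟨q, hq, hqp⟩
    obtain ⟨h, hB⟩ := (mem_bGraph_iff Tmin Tdag B q).1 hq
    refine Submodule.mem_sup.2 ⟨_, hB, _,
      ⟨p - ⟨q, h⟩, sub_eq_zero.2 hqp.symm, rfl⟩, ?_⟩
    rw [← map_add, add_sub_cancel]
  · intro hp
    obtain ⟨b, hb, _, ⟨c, hc, rfl⟩, hbc⟩ := Submodule.mem_sup.1 hp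
    refine ⟨(p - c).1, (mem_bGraph_iff Tmin Tdag B _).2 ⟨(p - c).2, ?_⟩, ?_⟩
    · change (minSub Tmin Tdag).mkQ (p - c) ∈ B
      rwa [map_sub, ← hbc, add_sub_cancel_right]
    · have hc' : c.1.2 = 0 := hc
      simp [hc']

/-- The range of `T_B` is closed if and only if `B + C` is. -/
theorem isClosed_ranOf_bGraph_iff (Tmin : H₁ →ₗ.[ℂ] H₂) (Tdag : H₂ →ₗ.[ℂ] H₁)
    (hd : Dense (Tdag.domain : Set H₂))
    (hR : IsClosed ((ranOf Tdag.adjoint.graph : Submodule ℂ H₂) : Set H₂))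
    (B : Submodule ℂ (HCheck Tmin Tdag)) :
    IsClosed ((ranOf (bGraph Tmin Tdag B) : Submodule ℂ H₂) : Set H₂) ↔
      IsClosed ((B ⊔ hardy Tmin Tdag : Submodule ℂ (HCheck Tmin Tdag)) :
        Set (HCheck Tmin Tdag)) := by
  have hq : Topology.IsQuotientMap (minSub Tmin Tdag).mkQ := isQuotientMap_quot_mk
  have : CompleteSpace Tdag.adjoint.graph :=
    IsClosed.completeSpace_coe (hs := LinearPMap.adjoint_isClosed hd)
  have : CompleteSpace (ranOf Tdag.adjoint.graph) := IsClosed.completeSpace_coe (hs := hR)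
  let f : Tdag.adjoint.graph →L[ℂ] ranOf Tdag.adjoint.graph :=
    ((ContinuousLinearMap.snd ℂ H₁ H₂).comp Tdag.adjoint.graph.subtypeL).codRestrict
      (ranOf Tdag.adjoint.graph) fun p => Submodule.mem_map_of_mem p.2
  have hf : Function.Surjective f := by
    rintro ⟨_, p, hp, rfl⟩
    exact ⟨⟨p, hp⟩, rfl⟩
  have hle : ranOf (bGraph Tmin Tdag B) ≤ ranOf Tdag.adjoint.graph := by
    rintro _ ⟨p, hp, rfl⟩
    exact Submodule.mem_map_of_mem ((mem_bGraph_iff Tmin Tdag B p).1 hp).1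
  have hpre : f ⁻¹' (Subtype.val ⁻¹' (ranOf (bGraph Tmin Tdag B) : Set H₂)) =
      (minSub Tmin Tdag).mkQ ⁻¹' (B ⊔ hardy Tmin Tdag : Submodule ℂ (HCheck Tmin Tdag)) := by
    ext p
    exact snd_mem_ranOf_bGraph_iff Tmin Tdag B p
  rw [← hq.isClosed_preimage, ← hpre, (f.isQuotientMap hf).isClosed_preimage]
  refine ⟨fun h => h.preimage continuous_subtype_val, fun h => ?_⟩
  have h2 := hR.isClosedEmbedding_subtypeVal.isClosedMap _ h
  have himg : Subtype.val '' (Subtype.val ⁻¹' (ranOf (bGraph Tmin Tdag B) : Set H₂) :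
      Set (ranOf Tdag.adjoint.graph)) = ranOf (bGraph Tmin Tdag B) :=
    Set.image_preimage_eq_of_subset fun y hy => ⟨⟨y, hle hy⟩, rfl⟩
  exact (congrArg IsClosed himg).mp h2

/-- The map induced by `T_max` from `ȟ/(B + C)` to the cokernel of `T_B`. -/
def cokerMap (Tmin : H₁ →ₗ.[ℂ] H₂) (Tdag : H₂ →ₗ.[ℂ] H₁)
    (B : Submodule ℂ (HCheck Tmin Tdag)) :
    HCheck Tmin Tdag ⧸ (B ⊔ hardy Tmin Tdag) →ₗ[ℂ] H₂ ⧸ ranOf (bGraph Tmin Tdag B) :=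
  Submodule.liftQ _ (Submodule.liftQ (minSub Tmin Tdag)
    ((ranOf (bGraph Tmin Tdag B)).mkQ ∘ₗ LinearMap.snd ℂ H₁ H₂ ∘ₗ Tdag.adjoint.graph.subtype)
    fun p hp => (Submodule.Quotient.mk_eq_zero _).2 ((snd_mem_ranOf_bGraph_iff Tmin Tdag B p).2 (by
      rw [Submodule.mkQ_apply, (Submodule.Quotient.mk_eq_zero _).2 hp]
      exact zero_mem _)))
    fun b hb => by
      obtain ⟨p, rfl⟩ := Submodule.mkQ_surjective _ b
      exact (Submodule.Quotient.mk_eq_zero _).2 ((snd_mem_ranOf_bGraph_iff Tmin Tdag B p).2 hb)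

theorem cokerMap_injective (Tmin : H₁ →ₗ.[ℂ] H₂) (Tdag : H₂ →ₗ.[ℂ] H₁)
    (B : Submodule ℂ (HCheck Tmin Tdag)) : Function.Injective (cokerMap Tmin Tdag B) := by
  rw [injective_iff_map_eq_zero]
  intro x hx
  obtain ⟨b, rfl⟩ := Submodule.mkQ_surjective _ x
  obtain ⟨p, rfl⟩ := Submodule.mkQ_surjective _ b
  exact (Submodule.Quotient.mk_eq_zero _).2
    ((snd_mem_ranOf_bGraph_iff Tmin Tdag B p).1 ((Submodule.Quotient.mk_eq_zero _).1 hx))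

theorem range_cokerMap (Tmin : H₁ →ₗ.[ℂ] H₂) (Tdag : H₂ →ₗ.[ℂ] H₁)
    (B : Submodule ℂ (HCheck Tmin Tdag)) :
    LinearMap.range (cokerMap Tmin Tdag B) =
      (ranOf Tdag.adjoint.graph).map (ranOf (bGraph Tmin Tdag B)).mkQ := by
  ext y
  constructor
  · rintro ⟨x, rfl⟩
    obtain ⟨b, rfl⟩ := Submodule.mkQ_surjective _ x
    obtain ⟨p, rfl⟩ := Submodule.mkQ_surjective _ b
    exact ⟨p.1.2, Submodule.mem_map_of_mem p.2, rfl⟩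
  · rintro ⟨_, ⟨p, hp, rfl⟩, rfl⟩
    exact ⟨Submodule.mkQ _ (Submodule.mkQ _ ⟨p, hp⟩), rfl⟩

/-- The quotient of the cokernel of `T_B` by the image of the range of `T_max` is isomorphic
to the kernel of `T_min†`. -/
theorem nonempty_quotient_range_cokerMap_equiv (Tmin : H₁ →ₗ.[ℂ] H₂) (Tdag : H₂ →ₗ.[ℂ] H₁)
    (hR : ranOf Tdag.adjoint.graph = (kerOf Tdag.graph)ᗮ)
    (hk : FiniteDimensional ℂ (kerOf Tdag.graph)) (B : Submodule ℂ (HCheck Tmin Tdag)) :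
    Nonempty (((H₂ ⧸ ranOf (bGraph Tmin Tdag B)) ⧸ LinearMap.range (cokerMap Tmin Tdag B))
      ≃ₗ[ℂ] kerOf Tdag.graph) := by
  have hle : ranOf (bGraph Tmin Tdag B) ≤ ranOf Tdag.adjoint.graph := by
    rintro _ ⟨p, hp, rfl⟩
    exact Submodule.mem_map_of_mem ((mem_bGraph_iff Tmin Tdag B p).1 hp).1
  rw [range_cokerMap]
  have hcompl : IsCompl (ranOf Tdag.adjoint.graph) (kerOf Tdag.graph) := by
    rw [hR]
    exact (kerOf Tdag.graph).isCompl_orthogonal.symm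
  exact ⟨(Submodule.quotientQuotientEquivQuotient _ _ hle).trans
    (Submodule.quotientEquivOfIsCompl _ _ hcompl)⟩

theorem finiteDimensional_coker_iff (Tmin : H₁ →ₗ.[ℂ] H₂) (Tdag : H₂ →ₗ.[ℂ] H₁)
    (hR : ranOf Tdag.adjoint.graph = (kerOf Tdag.graph)ᗮ)
    (hk : FiniteDimensional ℂ (kerOf Tdag.graph)) (B : Submodule ℂ (HCheck Tmin Tdag)) :
    FiniteDimensional ℂ (H₂ ⧸ ranOf (bGraph Tmin Tdag B)) ↔
      FiniteDimensional ℂ (HCheck Tmin Tdag ⧸ (B ⊔ hardy Tmin Tdag)) := by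
  obtain ⟨e⟩ := nonempty_quotient_range_cokerMap_equiv Tmin Tdag hR hk B
  refine ⟨fun _ => FiniteDimensional.of_injective _ (cokerMap_injective Tmin Tdag B),
    fun _ => ?_⟩
  have := e.symm.finiteDimensional
  exact Module.Finite.of_submodule_quotient (LinearMap.range (cokerMap Tmin Tdag B))

theorem finrank_coker (Tmin : H₁ →ₗ.[ℂ] H₂) (Tdag : H₂ →ₗ.[ℂ] H₁)
    (hR : ranOf Tdag.adjoint.graph = (kerOf Tdag.graph)ᗮ)
    (hk : FiniteDimensional ℂ (kerOf Tdag.graph)) (B : Submodule ℂ (HCheck Tmin Tdag))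
    (hF : FiniteDimensional ℂ (H₂ ⧸ ranOf (bGraph Tmin Tdag B))) :
    Module.finrank ℂ (H₂ ⧸ ranOf (bGraph Tmin Tdag B)) =
      Module.finrank ℂ (HCheck Tmin Tdag ⧸ (B ⊔ hardy Tmin Tdag)) +
        Module.finrank ℂ (kerOf Tdag.graph) := by
  obtain ⟨e⟩ := nonempty_quotient_range_cokerMap_equiv Tmin Tdag hR hk B
  rw [← e.finrank_eq, ← LinearMap.finrank_range_of_inj (cokerMap_injective Tmin Tdag B), add_comm,
    Submodule.finrank_quotient_add_finrank]

/-- The kernel of the adjoint of `T_B` is the orthogonal complement of the range of `T_B`. -/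
theorem kerOf_graph_adjoint_TB (Tmin : H₁ →ₗ.[ℂ] H₂) (Tdag : H₂ →ₗ.[ℂ] H₁)
    (hd : Dense (Tmin.domain : Set H₁)) (ha : Tmin ≤ Tdag.adjoint)
    (B : Submodule ℂ (HCheck Tmin Tdag)) :
    kerOf (TB Tmin Tdag B).adjoint.graph = (ranOf (bGraph Tmin Tdag B))ᗮ := by
  have hg : (TB Tmin Tdag B).graph = bGraph Tmin Tdag B := by
    refine Submodule.toLinearPMap_graph_eq _ fun p hp h0 => ?_
    exact Tdag.adjoint.graph_fst_eq_zero_snd ((mem_bGraph_iff Tmin Tdag B p).1 hp).1 h0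
  have hdB : Dense ((TB Tmin Tdag B).domain : Set H₁) := by
    refine hd.mono fun x hx => ?_
    exact Submodule.mem_map_of_mem (f := LinearMap.fst ℂ H₁ H₂)
      (graph_le_bGraph Tmin Tdag ha B (Tmin.mem_graph ⟨x, hx⟩))
  ext y
  refine (mem_graph_adjoint_iff _ hdB (y, 0)).trans ?_
  rw [hg, Submodule.mem_orthogonal]
  simpa [ranOf] using forall_comm

/-- `T†_{B*}` is the realisation of `T_min†` determined by `B*`. -/
theorem bGraph_adjBC (Tmin : H₁ →ₗ.[ℂ] H₂) (Tdag : H₂ →ₗ.[ℂ] H₁)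
    (hd : Dense (Tdag.domain : Set H₂)) (ha : Tdag ≤ Tmin.adjoint)
    (B : Submodule ℂ (HCheck Tmin Tdag)) :
    bGraph Tdag Tmin (adjBC Tmin Tdag B) = adjGraph Tmin Tdag B := by
  have hle : Tdag.graph ≤ adjGraph Tmin Tdag B := fun q hq =>
    ⟨LinearPMap.le_graph_of_le ha hq, fun p hp =>
      (mem_graph_adjoint_iff Tdag hd p).1 ((mem_bGraph_iff Tmin Tdag B p).1 hp).1 q hq⟩
  ext q
  rw [mem_bGraph_iff]
  constructor
  · rintro ⟨h, ⟨r, hr, hrq⟩⟩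
    have h1 : r - ⟨q, h⟩ ∈ minSub Tdag Tmin := (Submodule.Quotient.eq _).1 hrq
    have h2 := (adjGraph Tmin Tdag B).sub_mem hr (hle h1)
    simpa using h2
  · exact fun hq => ⟨hq.1, ⟨⟨q, hq.1⟩, hq, rfl⟩⟩

theorem kerOf_adjGraph (Tmin : H₁ →ₗ.[ℂ] H₂) (Tdag : H₂ →ₗ.[ℂ] H₁)
    (hd : Dense (Tmin.domain : Set H₁)) (ha : Tmin ≤ Tdag.adjoint)
    (B : Submodule ℂ (HCheck Tmin Tdag)) :
    kerOf (adjGraph Tmin Tdag B) = (ranOf (bGraph Tmin Tdag B))ᗮ := by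
  ext y
  rw [Submodule.mem_orthogonal']
  constructor
  · rintro hy _ ⟨p, hp, rfl⟩
    have h := hy.2 p hp
    simpa using h.symm
  · intro hy
    have hy' : ∀ p ∈ bGraph Tmin Tdag B, ⟪y, p.2⟫_ℂ = 0 := fun p hp =>
      hy _ (Submodule.mem_map_of_mem (f := LinearMap.snd ℂ H₁ H₂) hp)
    refine ⟨(mem_graph_adjoint_iff Tmin hd _).2 fun p hp => ?_, fun p hp => ?_⟩
    · have h := inner_eq_zero_symm.1 (hy' p (graph_le_bGraph Tmin Tdag ha B hp))
      simpa using h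
    · simpa using (hy' p hp).symm

/-- Let `(T_min, T_min†)` be a Fredholm FAP and `B ⊆ ȟ` a boundary
condition (closed subspace).  Then `T_B` is Fredholm iff `(B, C)` is a Fredholm pair in
`ȟ` (`C` the Hardy space).  In that case `B* ∩ C† ≅ ȟ/(B + C)` and
`ind(T_B) = ind(B, C) + dim ker(T_min) − dim ker(T_min†)`, where
`ind(T_B) = dim ker(T_B) − dim ker(T_B*)` and
`ind(B, C) = dim(B ∩ C) − dim(ȟ/(B + C))`. -/
theorem stmt_14 (Tmin : H₁ →ₗ.[ℂ] H₂) (Tdag : H₂ →ₗ.[ℂ] H₁)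
    (hd₁ : Dense (Tmin.domain : Set H₁)) (hd₂ : Dense (Tdag.domain : Set H₂))
    (hc₁ : Tmin.IsClosed) (hc₂ : Tdag.IsClosed)
    (ha₁ : Tmin ≤ Tdag.adjoint) (ha₂ : Tdag ≤ Tmin.adjoint)
    (hr₁ : IsClosed ((ranOf Tmin.graph : Submodule ℂ H₂) : Set H₂))
    (hr₂ : IsClosed ((ranOf Tdag.graph : Submodule ℂ H₁) : Set H₁))
    (hk₁ : FiniteDimensional ℂ (kerOf Tmin.graph))
    (hk₂ : FiniteDimensional ℂ (kerOf Tdag.graph))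
    (B : Submodule ℂ (HCheck Tmin Tdag)) (hB : IsClosed (B : Set (HCheck Tmin Tdag))) :
    -- `T_B` is Fredholm iff `(B, C)` is a Fredholm pair
    ((FiniteDimensional ℂ (kerOf (bGraph Tmin Tdag B)) ∧
      IsClosed ((ranOf (bGraph Tmin Tdag B) : Submodule ℂ H₂) : Set H₂) ∧
      FiniteDimensional ℂ (H₂ ⧸ ranOf (bGraph Tmin Tdag B))) ↔
     (FiniteDimensional ℂ ↥(B ⊓ hardy Tmin Tdag) ∧
      IsClosed ((B ⊔ hardy Tmin Tdag : Submodule ℂ (HCheck Tmin Tdag)) :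
        Set (HCheck Tmin Tdag)) ∧
      FiniteDimensional ℂ ((HCheck Tmin Tdag) ⧸ (B ⊔ hardy Tmin Tdag)))) ∧
    -- in the Fredholm case: `B* ∩ C† ≅ ȟ/(B + C)` and the index formula
    ((FiniteDimensional ℂ (kerOf (bGraph Tmin Tdag B)) ∧
      IsClosed ((ranOf (bGraph Tmin Tdag B) : Submodule ℂ H₂) : Set H₂) ∧
      FiniteDimensional ℂ (H₂ ⧸ ranOf (bGraph Tmin Tdag B))) →
      Nonempty (↥(adjBC Tmin Tdag B ⊓ hardy Tdag Tmin) ≃ₗ[ℂ]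
          ((HCheck Tmin Tdag) ⧸ (B ⊔ hardy Tmin Tdag))) ∧
      (Module.finrank ℂ (kerOf (bGraph Tmin Tdag B)) : ℤ) -
          (Module.finrank ℂ (kerOf (TB Tmin Tdag B).adjoint.graph) : ℤ) =
        ((Module.finrank ℂ ↥(B ⊓ hardy Tmin Tdag) : ℤ) -
            (Module.finrank ℂ ((HCheck Tmin Tdag) ⧸ (B ⊔ hardy Tmin Tdag)) : ℤ)) +
          (Module.finrank ℂ (kerOf Tmin.graph) : ℤ) -
          (Module.finrank ℂ (kerOf Tdag.graph) : ℤ)) := by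
  have hR := ranOf_graph_adjoint Tdag hd₂ hc₂ hr₂
  have hRc : IsClosed ((ranOf Tdag.adjoint.graph : Submodule ℂ H₂) : Set H₂) := by
    rw [hR]
    exact Submodule.isClosed_orthogonal _
  refine ⟨and_congr (finiteDimensional_kerOf_bGraph_iff Tmin Tdag ha₁ hk₁ B)
    (and_congr (isClosed_ranOf_bGraph_iff Tmin Tdag hd₂ hRc B)
      (finiteDimensional_coker_iff Tmin Tdag hR hk₂ B)), ?_⟩
  rintro ⟨hK, hcl, hF⟩
  have : CompleteSpace (ranOf (bGraph Tmin Tdag B)) := IsClosed.completeSpace_coe (hs := hcl)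
  let e : (H₂ ⧸ ranOf (bGraph Tmin Tdag B)) ≃ₗ[ℂ] ↥(ranOf (bGraph Tmin Tdag B))ᗮ :=
    Submodule.quotientEquivOfIsCompl _ _ (Submodule.isCompl_orthogonal _)
  have hQ := (finiteDimensional_coker_iff Tmin Tdag hR hk₂ B).1 hF
  have hcok := finrank_coker Tmin Tdag hR hk₂ B hF
  have hker := finrank_kerOf_bGraph Tmin Tdag ha₁ B hK
  have hadj : kerOf (bGraph Tdag Tmin (adjBC Tmin Tdag B)) = (ranOf (bGraph Tmin Tdag B))ᗮ := by
    rw [bGraph_adjBC Tmin Tdag hd₂ ha₂, kerOf_adjGraph Tmin Tdag hd₁ ha₁]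
  have hKa : FiniteDimensional ℂ (kerOf (bGraph Tdag Tmin (adjBC Tmin Tdag B))) := by
    rw [hadj]
    exact e.finiteDimensional
  have hBC := (finiteDimensional_kerOf_bGraph_iff Tdag Tmin ha₂ hk₂ _).1 hKa
  have hkera := finrank_kerOf_bGraph Tdag Tmin ha₂ _ hKa
  rw [hadj, ← e.finrank_eq, hcok] at hkera
  refine ⟨⟨LinearEquiv.ofFinrankEq _ _ (Nat.add_right_cancel hkera).symm⟩, ?_⟩
  rw [kerOf_graph_adjoint_TB Tmin Tdag hd₁ ha₁, ← e.finrank_eq, hcok, hker]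
  push_cast
  ring
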